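/- Let L : Sym(n) → Sym(n) be an affine isomorphism, L(X) = 𝒜X + B for a linear isomorphism 𝒜 and B ∈ Sym(n), such that L maps the closure of VPM(n) onto itself. Then L(0) + L(I) = I; consequently either L(0) = 0 and L(I) = I, or L(0) = I and L(I) = 0, given that L maps {0, I} into {0, I}. -/

import Mathlib

/-- The first claim; it does not need the hypothesis on the endpoints. -/
theorem vpm_sum_endpoints {n : ℕ}
    (𝒜 : Matrix (Fin n) (Fin n) ℝ ≃ₗ[ℝ] Matrix (Fin n) (Fin n) ℝ)
    (B : Matrix (Fin n) (Fin n) ℝ)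
    (L : Matrix (Fin n) (Fin n) ℝ → Matrix (Fin n) (Fin n) ℝ)
    (hL : ∀ X, L X = 𝒜 X + B)
    (hmap : L '' {X | X.PosSemidef ∧ (1 - X).PosSemidef} =
      {X | X.PosSemidef ∧ (1 - X).PosSemidef}) :
    L 0 + L 1 = 1 := by
  have aff : ∀ X, L (1 - X) = L 0 + L 1 - L X := by
    intro X
    simp only [hL, map_sub, map_zero]
    abel
  have key : ∀ Z : Matrix (Fin n) (Fin n) ℝ, Z.PosSemidef → (1 - Z).PosSemidef →
      (L 0 + L 1 - Z).PosSemidef ∧ (1 - (L 0 + L 1 - Z)).PosSemidef := by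
    intro Z h1 h2
    have hZ : Z ∈ L '' {X | X.PosSemidef ∧ (1 - X).PosSemidef} := by
      rw [hmap]; exact ⟨h1, h2⟩
    obtain ⟨X, ⟨hX1, hX2⟩, rfl⟩ := hZ
    have h : L (1 - X) ∈ L '' {X | X.PosSemidef ∧ (1 - X).PosSemidef} :=
      ⟨1 - X, ⟨hX2, by simpa using hX1⟩, rfl⟩
    rw [hmap, aff] at h
    exact h
  have h0 := (key 0 Matrix.PosSemidef.zero (by simpa using Matrix.PosSemidef.one)).2
  have h1 := (key 1 Matrix.PosSemidef.one (by simpa using Matrix.PosSemidef.zero)).1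
  rw [sub_zero] at h0
  open scoped MatrixOrder in
  exact le_antisymm (Matrix.le_iff.mpr h0) (Matrix.le_iff.mpr h1)

/-- An affine isomorphism `L X = 𝒜 X + B` mapping the closure of `VPM(n)` onto itself
satisfies `L 0 + L I = I`; hence, given that it maps `{0, I}` into `{0, I}`, either
`L 0 = 0 ∧ L I = I` or `L 0 = I ∧ L I = 0`. -/
theorem affine_iso_of_vpm_fixes_endpoints {n : ℕ}
    (𝒜 : Matrix (Fin n) (Fin n) ℝ ≃ₗ[ℝ] Matrix (Fin n) (Fin n) ℝ)
    (B : Matrix (Fin n) (Fin n) ℝ)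
    (L : Matrix (Fin n) (Fin n) ℝ → Matrix (Fin n) (Fin n) ℝ)
    (hL : ∀ X, L X = 𝒜 X + B)
    (hmap : L '' {X | X.PosSemidef ∧ (1 - X).PosSemidef} =
      {X | X.PosSemidef ∧ (1 - X).PosSemidef})
    (hends : L '' {0, 1} ⊆ ({0, 1} : Set (Matrix (Fin n) (Fin n) ℝ))) :
    L 0 + L 1 = 1 ∧ ((L 0 = 0 ∧ L 1 = 1) ∨ (L 0 = 1 ∧ L 1 = 0)) := by
  have hs := vpm_sum_endpoints 𝒜 B L hL hmap
  refine ⟨hs, ?_⟩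
  have h0 : L 0 = 0 ∨ L 0 = 1 := hends ⟨0, Or.inl rfl, rfl⟩
  rcases h0 with h | h
  · left
    rw [h, zero_add] at hs
    exact ⟨h, hs⟩
  · right
    rw [h, add_eq_left] at hs
    exact ⟨h, hs⟩
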